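/- Polynomial identity underlying the stability proof: let k ≥ 1 be an integer, let v be a real polynomial of degree at most k, and let V be any antiderivative of v (V' = v). Then the 2k-th derivative of the polynomial v'·V is constant and equals C(2k, k−1)·(v^{(k)})²; in particular, the 2k-th derivative of v'·V is everywhere nonnegative. -/

import Mathlib

open Polynomial

/-- **Polynomial identity underlying the stability proof.**
Let `k ≥ 1`, let `v` be a real polynomial of degree at most `k`, and let `V` be any
antiderivative of `v` (`V' = v`).  Then the `2k`-th derivative of the polynomial `v'·V`
is the constant polynomial `C(2k, k-1)·(v^{(k)})²` (where `v^{(k)}` is the constant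
`k`-th derivative of `v`); in particular the `2k`-th derivative of `v'·V` is everywhere
nonnegative. -/
theorem stability_polynomial_identity (k : ℕ) (hk : 1 ≤ k) (v V : Polynomial ℝ)
    (hv : v.degree ≤ (k : ℕ)) (hV : Polynomial.derivative V = v) :
    (⇑(Polynomial.derivative (R := ℝ)))^[2 * k] (Polynomial.derivative v * V) =
      Polynomial.C ((Nat.choose (2 * k) (k - 1) : ℝ) *
        (((⇑(Polynomial.derivative (R := ℝ)))^[k] v).coeff 0) ^ 2) ∧
    ∀ x : ℝ,
      0 ≤ ((⇑(Polynomial.derivative (R := ℝ)))^[2 * k]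
          (Polynomial.derivative v * V)).eval x := by
  have hw : derivative^[k] v = C ((derivative^[k] v).coeff 0) := by
    apply eq_C_of_natDegree_eq_zero
    have h := natDegree_iterate_derivative v k
    have := natDegree_le_of_degree_le hv
    omega
  have hzero : ∀ j, k < j → derivative^[j] v = 0 := fun j hj =>
    iterate_derivative_eq_zero ((natDegree_le_of_degree_le hv).trans_lt hj)
  have key : derivative^[2 * k] (derivative v * V) =
      C ((Nat.choose (2 * k) (k - 1) : ℝ) * ((derivative^[k] v).coeff 0) ^ 2) := by
    rw [iterate_derivative_mul, Finset.sum_eq_single (k + 1)]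
    · have h₁ : derivative^[2 * k - (k + 1)] (derivative v) = derivative^[k] v := by
        rw [← Function.iterate_succ_apply]
        congr 2
        omega
      have h₂ : derivative^[k + 1] V = derivative^[k] v := by
        rw [Function.iterate_succ_apply, hV]
      have h₃ : (2 * k).choose (k + 1) = (2 * k).choose (k - 1) :=
        Nat.choose_symm_of_eq_add (by omega)
      rw [h₁, h₂, h₃, hw, coeff_C_zero, nsmul_eq_mul, C_mul, C_pow, C_eq_natCast, sq]
    · intro j _ hj
      rcases lt_or_gt_of_ne hj with h | h
      · rw [← Function.iterate_succ_apply, hzero _ (by omega), zero_mul, smul_zero]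
      · obtain ⟨i, rfl⟩ : ∃ i, j = i + 1 := ⟨j - 1, by omega⟩
        rw [Function.iterate_succ_apply _ i V, hV, hzero i (by omega), mul_zero, smul_zero]
    · intro h
      exact absurd (Finset.mem_range.mpr (by omega)) h
  refine ⟨key, fun x => ?_⟩
  rw [key, eval_C]
  positivity
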